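/- If x1, x1', x2, x3, x4 ∈ X with x1' ⪰ x1, then |H((x1' − x1) ∗ (x2 − x3) ∗ x4)| ≤ H(x1' − x1), where ∗ denotes either ⊛ or ⊠ (the same operation in both places), and the operations and H are extended bilinearly and linearly to signed measures. -/

import Mathlib

open MeasureTheory Real Filter Topology Polynomial

noncomputable section

/-- The space of finite signed Borel measures on the extended reals `ℝ̄`. -/
abbrev SM := MeasureTheory.SignedMeasure EReal

namespace SCLDPC

/-- The weight `e^{-α/2}` as an extended nonnegative real (`+∞` at `α = -∞`). -/
def wt (α : EReal) : ENNReal :=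
  if α = ⊥ then ⊤ else if α = ⊤ then 0 else ENNReal.ofReal (Real.exp (-(α.toReal) / 2))

/-- A (nonnegative) Borel measure `μ` on `ℝ̄` is symmetric if
`∫_{-E} e^{-α/2} μ(dα) = ∫_{E} e^{-α/2} μ(dα)` for every Borel set `E`
(stated with extended nonnegative integrals, which is equivalent to requiring
equality whenever one of the two sides is finite). -/
def IsSymmMeasure (μ : Measure EReal) : Prop :=
  ∀ E : Set EReal, MeasurableSet E →
    ∫⁻ α in (fun a : EReal => -a) ⁻¹' E, wt α ∂μ = ∫⁻ α in E, wt α ∂μ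

/-- Positive part of the Jordan decomposition. -/
def jp (x : SM) : Measure EReal := x.toJordanDecomposition.posPart

/-- Negative part of the Jordan decomposition. -/
def jn (x : SM) : Measure EReal := x.toJordanDecomposition.negPart

instance (x : SM) : IsFiniteMeasure (jp x) := x.toJordanDecomposition.posPart_finite

instance (x : SM) : IsFiniteMeasure (jn x) := x.toJordanDecomposition.negPart_finite

/-- A finite signed Borel measure on `ℝ̄` is symmetric iff both parts of its Jordan
decomposition are symmetric measures. -/
def IsSymm (x : SM) : Prop := IsSymmMeasure (jp x) ∧ IsSymmMeasure (jn x)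

/-- Membership in `X`, the set of symmetric probability measures on `ℝ̄`. -/
def MemX (x : SM) : Prop :=
  (∃ (μ : Measure EReal) (hμ : IsProbabilityMeasure μ),
      x = (letI := hμ; μ.toSignedMeasure)) ∧ IsSymm x

/-- Membership in `X_d`, the set of differences of symmetric probability measures. -/
def MemXd (y : SM) : Prop := ∃ x1 x2 : SM, MemX x1 ∧ MemX x2 ∧ y = x1 - x2

/-- Integral of a real function against a finite signed measure. -/
def sInt (f : EReal → ℝ) (x : SM) : ℝ := (∫ α, f α ∂(jp x)) - ∫ α, f α ∂(jn x)

/-- `tanh(α/2)` extended continuously to `ℝ̄`. -/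
def tanhHalf (α : EReal) : ℝ :=
  if α = ⊤ then 1 else if α = ⊥ then -1 else Real.tanh (α.toReal / 2)

/-- The inverse hyperbolic tangent on `(-1, 1)`. -/
def artanh (t : ℝ) : ℝ := Real.log ((1 + t) / (1 - t)) / 2

/-- `2 tanh⁻¹(t)` valued in `ℝ̄` (sending `t ≥ 1` to `+∞` and `t ≤ -1` to `-∞`). -/
def atanhTwo (t : ℝ) : EReal :=
  if 1 ≤ t then ⊤ else if t ≤ -1 then ⊥ else ((2 * artanh t : ℝ) : EReal)

/-- Variable-node convolution `⊛` of two (nonnegative) measures: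
`(μ ⊛ ν)(E) = ∫ μ(E - α) ν(dα)`, i.e. the pushforward of `μ × ν` under addition. -/
def mConv (μ ν : Measure EReal) : Measure EReal :=
  (μ.prod ν).map fun p => p.1 + p.2

/-- Check-node convolution `⊠` of two (nonnegative) measures:
`(μ ⊠ ν)(E) = ∫ μ(2 tanh⁻¹(tanh(E/2) / tanh(α/2))) ν(dα)`, where the argument of `μ`
is the image of `E` under `β ↦ 2 tanh⁻¹(tanh(β/2) / tanh(α/2))`; equivalently, the
pushforward of `μ × ν` under `(β, α) ↦ 2 tanh⁻¹(tanh(β/2) · tanh(α/2))`. -/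
def mCheck (μ ν : Measure EReal) : Measure EReal :=
  (μ.prod ν).map fun p => atanhTwo (tanhHalf p.1 * tanhHalf p.2)

instance (μ ν : Measure EReal) [IsFiniteMeasure μ] [IsFiniteMeasure ν] :
    IsFiniteMeasure (mConv μ ν) := by unfold mConv; infer_instance

instance (μ ν : Measure EReal) [IsFiniteMeasure μ] [IsFiniteMeasure ν] :
    IsFiniteMeasure (mCheck μ ν) := by unfold mCheck; infer_instance

/-- The variable-node operation `⊛` extended bilinearly to finite signed measures. -/
def sConv (x y : SM) : SM :=
  (mConv (jp x) (jp y)).toSignedMeasure - (mConv (jp x) (jn y)).toSignedMeasure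
    - (mConv (jn x) (jp y)).toSignedMeasure + (mConv (jn x) (jn y)).toSignedMeasure

/-- The check-node operation `⊠` extended bilinearly to finite signed measures. -/
def sCheck (x y : SM) : SM :=
  (mCheck (jp x) (jp y)).toSignedMeasure - (mCheck (jp x) (jn y)).toSignedMeasure
    - (mCheck (jn x) (jp y)).toSignedMeasure + (mCheck (jn x) (jn y)).toSignedMeasure

/-- The integrand `log₂(1 + e^{-α})` of the entropy functional (with the harmless
convention that it vanishes at `α = ±∞`; symmetric measures put no mass at `-∞`). -/
def entFn (α : EReal) : ℝ :=
  if α = ⊤ then 0 else if α = ⊥ then 0 else Real.logb 2 (1 + Real.exp (-(α.toReal)))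

/-- The entropy functional `H(x) = ∫ log₂(1 + e^{-α}) x(dα)`. -/
def H (x : SM) : ℝ := sInt entFn x

/-- `I_f(x) = ∫ f(|tanh(α/2)|) x(dα)`. -/
def If (f : ℝ → ℝ) (x : SM) : ℝ := sInt (fun α => f |tanhHalf α|) x

/-- `x1` is degraded with respect to `x2` (written `x1 ⪰ x2`): `I_f(x1) ≥ I_f(x2)` for
every concave non-increasing `f : [0,1] → ℝ`. -/
def Degraded (x1 x2 : SM) : Prop :=
  ∀ f : ℝ → ℝ, ConcaveOn ℝ (Set.Icc (0 : ℝ) 1) f → AntitoneOn f (Set.Icc (0 : ℝ) 1) →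
    If f x2 ≤ If f x1

/-- `x1` is strictly degraded with respect to `x2` (written `x1 ≻ x2`). -/
def StrictlyDegraded (x1 x2 : SM) : Prop :=
  Degraded x1 x2 ∧ ∃ f : ℝ → ℝ, ConcaveOn ℝ (Set.Icc (0 : ℝ) 1) f ∧
    AntitoneOn f (Set.Icc (0 : ℝ) 1) ∧ If f x2 < If f x1


/-- Paired terms of the series of `log (1 + t)`. -/
def Ft (j : ℕ) (t : ℝ) : ℝ := t ^ (2 * j + 1) / (2 * j + 1) - t ^ (2 * j + 2) / (2 * j + 2)

def cc (j : ℕ) : ℝ := 1 / (2 * j + 1) - 1 / (2 * j + 2)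

lemma cc_nonneg (j : ℕ) : 0 ≤ cc j := by
  unfold cc
  rw [sub_nonneg]
  apply one_div_le_one_div_of_le <;> first | positivity | linarith

lemma partial_one (n : ℕ) :
    ∑ j ∈ Finset.range n, Ft j 1 = (harmonic (2 * n) : ℝ) - harmonic n := by
  induction n with
  | zero => simp
  | succ n ih =>
    rw [Finset.sum_range_succ, ih, show 2 * (n + 1) = 2 * n + 1 + 1 by ring, harmonic_succ,
      harmonic_succ, harmonic_succ]
    unfold Ft
    push_cast
    have h1 : (2 * (n : ℝ) + 1) ≠ 0 := by positivity
    have h2 : ((n : ℝ) + 1) ≠ 0 := by positivity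
    have h3 : (2 * (n : ℝ) + 1 + 1) ≠ 0 := by positivity
    have h4 : (2 * (n : ℝ) + 2) ≠ 0 := by positivity
    simp only [one_pow]
    field_simp
    ring

lemma Ft_nonneg (j : ℕ) {t : ℝ} (h0 : 0 ≤ t) (h1 : t ≤ 1) : 0 ≤ Ft j t := by
  unfold Ft
  rw [sub_nonneg]
  have : t ^ (2 * j + 2) ≤ t ^ (2 * j + 1) := pow_le_pow_of_le_one h0 h1 (by omega)
  apply div_le_div₀ <;> first | positivity | linarith

lemma Ft_nonpos (j : ℕ) {t : ℝ} (h0 : t ≤ 0) : Ft j t ≤ 0 := by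
  unfold Ft
  have h1 : t ^ (2 * j + 1) ≤ 0 := Odd.pow_nonpos ⟨j, rfl⟩ h0
  have h2 : 0 ≤ t ^ (2 * j + 2) := Even.pow_nonneg ⟨j + 1, by ring⟩ t
  have h3 : t ^ (2 * j + 1) / (2 * j + 1) ≤ 0 := div_nonpos_of_nonpos_of_nonneg h1 (by positivity)
  have h4 : 0 ≤ t ^ (2 * j + 2) / (2 * (j : ℝ) + 2) := by positivity
  linarith

lemma hasSum_Ft_one : HasSum (fun j => Ft j 1) (Real.log (1 + 1)) := by
  rw [hasSum_iff_tendsto_nat_of_nonneg (fun j => Ft_nonneg j zero_le_one le_rfl)]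
  have h := Real.tendsto_harmonic_sub_log
  have h2 : Tendsto (fun n : ℕ => 2 * n) atTop atTop := by
    apply tendsto_atTop_mono (fun n => ?_) tendsto_id
    simp only [id]; omega
  have h3 := ((h.comp h2).sub h).add_const (Real.log 2)
  rw [sub_self, zero_add] at h3
  norm_num
  refine h3.congr' ?_
  filter_upwards [eventually_gt_atTop 0] with n hn
  rw [partial_one]
  have : (n : ℝ) ≠ 0 := by positivity
  simp only [Function.comp]
  push_cast
  rw [Real.log_mul (by norm_num) this]
  ring

lemma hasSum_Ft {t : ℝ} (h0 : -1 < t) (h1 : t ≤ 1) :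
    HasSum (fun j => Ft j t) (Real.log (1 + t)) := by
  rcases eq_or_lt_of_le h1 with rfl | h1
  · exact hasSum_Ft_one
  have h := (Real.hasSum_pow_div_log_of_abs_lt_one (x := -t)
    (by rw [abs_neg, abs_lt]; exact ⟨h0, h1⟩)).neg
  obtain ⟨g, hg⟩ : ∃ g : ℕ → ℝ, g = fun n : ℕ => -((-t) ^ (n + 1) / ((n : ℝ) + 1)) := ⟨_, rfl⟩
  rw [sub_neg_eq_add, neg_neg, ← hg] at h
  have he : Summable fun k : ℕ => g (2 * k) :=
    h.summable.comp_injective (i := fun k : ℕ => 2 * k) (fun a b hab => by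
      have : 2 * a = 2 * b := hab
      omega)
  have ho : Summable fun k : ℕ => g (2 * k + 1) :=
    h.summable.comp_injective (i := fun k : ℕ => 2 * k + 1) (fun a b hab => by
      have : 2 * a + 1 = 2 * b + 1 := hab
      omega)
  have h3 := he.hasSum.add ho.hasSum
  rw [tsum_even_add_odd he ho, h.tsum_eq] at h3
  refine h3.congr_fun ?_
  intro j
  rw [hg]
  unfold Ft
  have a1 : (-t) ^ (2 * j + 1) = - t ^ (2 * j + 1) := Odd.neg_pow ⟨j, rfl⟩ t
  have a2 : (-t) ^ (2 * j + 1 + 1) = t ^ (2 * j + 2) := Even.neg_pow ⟨j + 1, by ring⟩ t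
  simp only [a1, a2]
  push_cast
  ring

lemma th_coe (a : ℝ) : tanhHalf (a : EReal) = (Real.exp a - 1) / (Real.exp a + 1) := by
  simp only [tanhHalf, EReal.coe_ne_top, EReal.coe_ne_bot, if_false, EReal.toReal_coe]
  rw [Real.tanh_eq_sinh_div_cosh, Real.sinh_eq, Real.cosh_eq]
  have : Real.exp a = Real.exp (a / 2) * Real.exp (a / 2) := by rw [← Real.exp_add]; ring_nf
  rw [this, Real.exp_neg]
  have := Real.exp_pos (a / 2)
  field_simp

@[simp] lemma th_top : tanhHalf ⊤ = 1 := by simp [tanhHalf]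
@[simp] lemma th_bot : tanhHalf ⊥ = -1 := by simp [tanhHalf]

lemma th_coe_lt (a : ℝ) : tanhHalf a < 1 := by
  rw [th_coe, div_lt_one (by positivity)]; linarith

lemma neg_one_lt_th_coe (a : ℝ) : -1 < tanhHalf a := by
  rw [th_coe, lt_div_iff₀ (by positivity)]; linarith [Real.exp_pos a]

lemma th_le (α : EReal) : tanhHalf α ≤ 1 := by
  induction α with
  | bot => simp
  | top => simp
  | coe a => exact (th_coe_lt a).le

lemma neg_one_le_th (α : EReal) : -1 ≤ tanhHalf α := by
  induction α with
  | bot => simp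
  | top => simp
  | coe a => exact (neg_one_lt_th_coe a).le

lemma neg_one_lt_th {α : EReal} (h : α ≠ ⊥) : -1 < tanhHalf α := by
  induction α with
  | bot => simp at h
  | top => simp
  | coe a => exact (neg_one_lt_th_coe a)

lemma abs_th_le (α : EReal) : |tanhHalf α| ≤ 1 := abs_le.2 ⟨neg_one_le_th α, th_le α⟩

lemma th_neg (α : EReal) : tanhHalf (-α) = - tanhHalf α := by
  induction α with
  | bot => simp
  | top => simp
  | coe a =>
    rw [← EReal.coe_neg, th_coe, th_coe, Real.exp_neg]
    have := Real.exp_pos a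
    field_simp
    ring

lemma entFn_eq {α : EReal} (h : α ≠ ⊥) :
    entFn α = 1 - Real.log (1 + tanhHalf α) / Real.log 2 := by
  have h2 : Real.log 2 ≠ 0 := by positivity
  induction α with
  | bot => simp at h
  | top => simp [entFn]; norm_num [h2]
  | coe a =>
    simp only [entFn, EReal.coe_ne_top, EReal.coe_ne_bot, if_false, EReal.toReal_coe]
    have := Real.exp_pos a
    rw [th_coe, Real.logb, eq_sub_iff_add_eq, ← add_div, ← Real.log_mul (by positivity), Real.exp_neg]
    · rw [div_eq_one_iff_eq h2]
      congr 1
      field_simp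
      ring
    · have : 1 + (Real.exp a - 1) / (Real.exp a + 1) = 2 * Real.exp a / (Real.exp a + 1) := by
        field_simp; ring
      rw [this]; positivity

lemma measurable_th : Measurable tanhHalf := by
  unfold tanhHalf
  refine Measurable.ite (measurableSet_singleton _) measurable_const
    (Measurable.ite (measurableSet_singleton _) measurable_const ?_)
  have : Measurable Real.tanh := by
    have e : Real.tanh = fun x => Real.sinh x / Real.cosh x :=
      funext fun x => Real.tanh_eq_sinh_div_cosh x
    rw [e]; exact Real.measurable_sinh.div Real.measurable_cosh
  exact this.comp (measurable_ereal_toReal.div_const 2)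

lemma measurable_entFn : Measurable entFn := by
  unfold entFn
  refine Measurable.ite (measurableSet_singleton _) measurable_const
    (Measurable.ite (measurableSet_singleton _) measurable_const ?_)
  unfold Real.logb
  have := measurable_ereal_toReal
  fun_prop

lemma measurable_atanhTwo : Measurable atanhTwo := by
  unfold atanhTwo artanh
  refine Measurable.ite measurableSet_Ici measurable_const
    (Measurable.ite measurableSet_Iic measurable_const ?_)
  refine measurable_coe_real_ereal.comp ?_
  fun_prop

lemma th_atanhTwo {u : ℝ} (h0 : -1 ≤ u) (h1 : u ≤ 1) : tanhHalf (atanhTwo u) = u := by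
  unfold atanhTwo
  split_ifs with ha hb
  · simp; linarith
  · simp; linarith
  · push Not at ha hb
    have e1 : 0 < 1 - u := by linarith
    have e2 : 0 < 1 + u := by linarith
    rw [th_coe, artanh, mul_div_cancel₀ _ (two_ne_zero), Real.exp_log (by positivity)]
    field_simp
    ring

lemma atanhTwo_ne_bot {u : ℝ} (h0 : -1 < u) : atanhTwo u ≠ ⊥ := by
  unfold atanhTwo
  split_ifs with ha hb
  · simp
  · linarith
  · exact EReal.coe_ne_bot _

/-- Check-node combination of two log-likelihood ratios. -/
def box (α β : EReal) : EReal := atanhTwo (tanhHalf α * tanhHalf β)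

lemma abs_th_mul (α β : EReal) : |tanhHalf α * tanhHalf β| ≤ 1 := by
  rw [abs_mul]; exact mul_le_one₀ (abs_th_le _) (abs_nonneg _) (abs_th_le _)

lemma th_box (α β : EReal) : tanhHalf (box α β) = tanhHalf α * tanhHalf β :=
  th_atanhTwo (abs_le.1 (abs_th_mul α β)).1 (abs_le.1 (abs_th_mul α β)).2

lemma one_add_mul_pos {t s : ℝ} (h0 : -1 < t) (h1 : t ≤ 1) (h2 : -1 < s) (h3 : s ≤ 1) :
    0 < 1 + t * s := by
  rcases le_total 0 t with h | h
  · rcases le_total 0 s with h' | h'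
    · positivity
    · nlinarith
  · nlinarith

lemma one_add_th_pos {α β : EReal} (ha : α ≠ ⊥) (hb : β ≠ ⊥) :
    0 < 1 + tanhHalf α * tanhHalf β :=
  one_add_mul_pos (neg_one_lt_th ha) (th_le _) (neg_one_lt_th hb) (th_le _)

lemma box_ne_bot {α β : EReal} (ha : α ≠ ⊥) (hb : β ≠ ⊥) : box α β ≠ ⊥ :=
  atanhTwo_ne_bot (by linarith [one_add_th_pos ha hb])

lemma th_add {α β : EReal} (ha : α ≠ ⊥) (hb : β ≠ ⊥) :
    tanhHalf (α + β) = (tanhHalf α + tanhHalf β) / (1 + tanhHalf α * tanhHalf β) := by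
  have h0 := (one_add_th_pos ha hb).ne'
  rw [eq_div_iff h0]
  induction α with
  | bot => simp at ha
  | top => rw [EReal.top_add_of_ne_bot hb]; simp
  | coe a =>
    induction β with
    | bot => simp at hb
    | top => rw [EReal.add_top_of_ne_bot ha]; simp; ring
    | coe b =>
      rw [← EReal.coe_add, th_coe, th_coe, th_coe, Real.exp_add]
      have := Real.exp_pos a
      have := Real.exp_pos b
      field_simp
      ring

lemma entFn_dual {α β : EReal} (ha : α ≠ ⊥) (hb : β ≠ ⊥) :
    entFn (α + β) = entFn α + entFn β - entFn (box α β) := by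
  have hab : α + β ≠ ⊥ := by simp [EReal.add_eq_bot_iff, ha, hb]
  rw [entFn_eq ha, entFn_eq hb, entFn_eq hab, entFn_eq (box_ne_bot ha hb), th_box, th_add ha hb]
  have h0 := one_add_th_pos ha hb
  have h1 := neg_one_lt_th ha
  have h2 := neg_one_lt_th hb
  have e : 1 + (tanhHalf α + tanhHalf β) / (1 + tanhHalf α * tanhHalf β)
     = (1 + tanhHalf α) * (1 + tanhHalf β) / (1 + tanhHalf α * tanhHalf β) := by
    field_simp; ring
  have p1 : 1 + tanhHalf α ≠ 0 := by linarith
  have p2 : 1 + tanhHalf β ≠ 0 := by linarith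
  rw [e, Real.log_div (mul_ne_zero p1 p2) h0.ne', Real.log_mul p1 p2]
  ring

lemma integrable_bdd {X : Type*} [MeasurableSpace X] (μ : Measure X) [IsFiniteMeasure μ] {f : X → ℝ} (hf : Measurable f)
    (C : ℝ) (h : ∀ a, |f a| ≤ C) : Integrable f μ :=
  Integrable.of_bound hf.aestronglyMeasurable C (Eventually.of_forall h)

/-- Even moments of `tanh(α/2)`. -/
def Mo (μ : Measure EReal) (k : ℕ) : ℝ := ∫ α, tanhHalf α ^ (2 * k + 2) ∂μ

structure Good (μ : Measure EReal) : Prop where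
  bot : ∀ᵐ α ∂μ, α ≠ ⊥
  odd : ∀ k : ℕ, ∫ α, tanhHalf α ^ (2 * k + 1) ∂μ = ∫ α, tanhHalf α ^ (2 * k + 2) ∂μ

lemma integrable_th_pow (μ : Measure EReal) [IsFiniteMeasure μ] (n : ℕ) :
    Integrable (fun α => tanhHalf α ^ n) μ :=
  integrable_bdd μ (measurable_th.pow_const n) 1 (fun a => by
    rw [abs_pow]; exact pow_le_one₀ (abs_nonneg _) (abs_th_le a))

lemma Mo_nonneg (μ : Measure EReal) (k : ℕ) : 0 ≤ Mo μ k :=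
  integral_nonneg fun α => Even.pow_nonneg ⟨k + 1, by ring⟩ _

lemma Mo_le_one (μ : Measure EReal) [IsProbabilityMeasure μ] (k : ℕ) : Mo μ k ≤ 1 := by
  have : Mo μ k ≤ ∫ _, (1 : ℝ) ∂μ :=
    integral_mono (integrable_th_pow μ _) (integrable_const _) (fun α => by
      have := pow_le_one₀ (n := 2 * k + 2) (abs_nonneg _) (abs_th_le α)
      rw [← abs_pow] at this
      exact (le_abs_self _).trans this)
  simpa using this

lemma integrable_Ft (μ : Measure EReal) [IsFiniteMeasure μ] (j : ℕ) :
    Integrable (fun α => Ft j (tanhHalf α)) μ :=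
  ((integrable_th_pow μ _).div_const _).sub ((integrable_th_pow μ _).div_const _)

lemma integral_Ft {μ : Measure EReal} [IsFiniteMeasure μ] (h : Good μ) (j : ℕ) :
    ∫ α, Ft j (tanhHalf α) ∂μ = cc j * Mo μ j := by
  unfold Ft
  rw [integral_sub ((integrable_th_pow μ _).div_const _) ((integrable_th_pow μ _).div_const _),
    integral_div, integral_div, h.odd]
  unfold cc Mo
  ring

lemma max_th_mem (α : EReal) : 0 ≤ max (tanhHalf α) 0 ∧ max (tanhHalf α) 0 ≤ 1 :=
  ⟨le_max_right _ _, max_le (th_le α) zero_le_one⟩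

lemma integrable_Ft_max (μ : Measure EReal) [IsFiniteMeasure μ] (j : ℕ) :
    Integrable (fun α => Ft j (max (tanhHalf α) 0)) μ := by
  have h : ∀ n : ℕ, Integrable (fun α => max (tanhHalf α) 0 ^ n) μ := fun n =>
    integrable_bdd μ ((measurable_th.max measurable_const).pow_const n) 1 (fun a => by
      rw [abs_pow, abs_of_nonneg (max_th_mem a).1]
      exact pow_le_one₀ (max_th_mem a).1 (max_th_mem a).2)
  exact ((h _).div_const _).sub ((h _).div_const _)

lemma norm_Ft (j : ℕ) {t : ℝ} (h1 : t ≤ 1) : ‖Ft j t‖ = 2 * Ft j (max t 0) - Ft j t := by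
  rcases le_total 0 t with h | h
  · rw [max_eq_left h, Real.norm_of_nonneg (Ft_nonneg j h h1)]; ring
  · rw [max_eq_right h, Real.norm_of_nonpos (Ft_nonpos j h)]
    simp [Ft]

lemma summable_norm_Ft {μ : Measure EReal} [IsFiniteMeasure μ] (h : Good μ) :
    Summable fun j => ∫ α, ‖Ft j (tanhHalf α)‖ ∂μ := by
  have hs : Summable fun j => ∫ α, Ft j (max (tanhHalf α) 0) ∂μ := by
    refine summable_of_sum_range_le (c := ∫ _, Real.log 2 ∂μ)
      (fun j => integral_nonneg fun α => Ft_nonneg j (max_th_mem α).1 (max_th_mem α).2) (fun n => ?_)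
    rw [← integral_finsetSum _ (fun j _ => integrable_Ft_max μ j)]
    refine integral_mono (integrable_finsetSum _ (fun j _ => integrable_Ft_max μ j))
      (integrable_const _) (fun α => ?_)
    have hm := max_th_mem α
    refine (sum_le_hasSum _ (fun j _ => Ft_nonneg j hm.1 hm.2)
      (hasSum_Ft (by linarith) hm.2)).trans ?_
    apply Real.log_le_log <;> linarith
  refine Summable.of_nonneg_of_le (fun j => integral_nonneg fun α => norm_nonneg _) (fun j => ?_)
    (hs.mul_left 2)
  simp_rw [norm_Ft j (th_le _)]
  rw [integral_sub ((integrable_Ft_max μ j).const_mul 2) (integrable_Ft μ j), integral_const_mul,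
    integral_Ft h]
  have := mul_nonneg (cc_nonneg j) (Mo_nonneg μ j)
  linarith

lemma ae_tsum {μ : Measure EReal} (h : Good μ) :
    ∀ᵐ α ∂μ, ∑' j, Ft j (tanhHalf α) = Real.log (1 + tanhHalf α) := by
  filter_upwards [h.bot] with α hα
  exact (hasSum_Ft (neg_one_lt_th hα) (th_le α)).tsum_eq

lemma integrable_log {μ : Measure EReal} [IsFiniteMeasure μ] (h : Good μ) :
    Integrable (fun α => Real.log (1 + tanhHalf α)) μ := by
  refine ⟨(Real.measurable_log.comp (measurable_const.add measurable_th)).aestronglyMeasurable, ?_⟩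
  unfold HasFiniteIntegral
  have hs := summable_norm_Ft h
  have : ∫⁻ α, ‖Real.log (1 + tanhHalf α)‖ₑ ∂μ ≤ ∫⁻ α, ∑' j, ‖Ft j (tanhHalf α)‖ₑ ∂μ := by
    apply lintegral_mono_ae
    filter_upwards [ae_tsum h] with α hα
    rw [← hα]
    exact enorm_tsum_le_tsum_enorm
  refine this.trans_lt ?_
  rw [lintegral_tsum (fun j => (integrable_Ft μ j).1.enorm)]
  simp_rw [← ofReal_integral_norm_eq_lintegral_enorm (integrable_Ft μ _)]
  exact hs.tsum_ofReal_lt_top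

lemma hasSum_log {μ : Measure EReal} [IsFiniteMeasure μ] (h : Good μ) :
    HasSum (fun j => cc j * Mo μ j) (∫ α, Real.log (1 + tanhHalf α) ∂μ) := by
  have := hasSum_integral_of_summable_integral_norm (integrable_Ft μ) (summable_norm_Ft h)
  rw [integral_congr_ae (ae_tsum h)] at this
  simpa only [integral_Ft h] using this

lemma entFn_ae {μ : Measure EReal} (h : Good μ) :
    entFn =ᵐ[μ] fun α => 1 - Real.log (1 + tanhHalf α) / Real.log 2 := by
  filter_upwards [h.bot] with α hα using entFn_eq hα

lemma integrable_ent {μ : Measure EReal} [IsFiniteMeasure μ] (h : Good μ) :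
    Integrable entFn μ :=
  (((integrable_const 1).sub ((integrable_log h).div_const _)).congr (entFn_ae h).symm)

/-- Entropy of a measure. -/
def E (μ : Measure EReal) : ℝ := ∫ α, entFn α ∂μ

lemma hasSum_E {μ : Measure EReal} [IsProbabilityMeasure μ] (h : Good μ) :
    HasSum (fun j => cc j * Mo μ j / Real.log 2) (1 - E μ) := by
  have : E μ = 1 - (∫ α, Real.log (1 + tanhHalf α) ∂μ) / Real.log 2 := by
    unfold E
    rw [integral_congr_ae (entFn_ae h), integral_sub (integrable_const 1) ((integrable_log h).div_const _),
      integral_div]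
    simp
  rw [this, sub_sub_cancel]
  exact (hasSum_log h).div_const _

lemma measurable_box : Measurable fun p : EReal × EReal => box p.1 p.2 :=
  measurable_atanhTwo.comp ((measurable_th.comp measurable_fst).mul (measurable_th.comp measurable_snd))

lemma mCheck_eq (μ ν : Measure EReal) : mCheck μ ν = (μ.prod ν).map fun p => box p.1 p.2 := rfl

lemma moment_check (μ ν : Measure EReal) [IsFiniteMeasure μ] [IsFiniteMeasure ν] (n : ℕ) :
    ∫ α, tanhHalf α ^ n ∂(mCheck μ ν) = (∫ α, tanhHalf α ^ n ∂μ) * ∫ α, tanhHalf α ^ n ∂ν := by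
  rw [mCheck_eq, integral_map measurable_box.aemeasurable
    (measurable_th.pow_const n).aestronglyMeasurable]
  simp_rw [th_box, mul_pow]
  exact integral_prod_mul (fun α => tanhHalf α ^ n) (fun α => tanhHalf α ^ n)

lemma ae_prod_ne_bot {μ ν : Measure EReal} [IsFiniteMeasure μ] [IsFiniteMeasure ν]
    (hμ : ∀ᵐ α ∂μ, α ≠ ⊥) (hν : ∀ᵐ α ∂ν, α ≠ ⊥) :
    ∀ᵐ p ∂(μ.prod ν), p.1 ≠ ⊥ ∧ p.2 ≠ ⊥ :=
  (Measure.quasiMeasurePreserving_fst.ae hμ).and (Measure.quasiMeasurePreserving_snd.ae hν)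

lemma Good.check {μ ν : Measure EReal} [IsFiniteMeasure μ] [IsFiniteMeasure ν]
    (hμ : Good μ) (hν : Good ν) : Good (mCheck μ ν) := by
  constructor
  · rw [mCheck_eq, ae_map_iff measurable_box.aemeasurable
      (p := fun α : EReal => α ≠ ⊥) (measurableSet_singleton _).compl]
    filter_upwards [ae_prod_ne_bot hμ.bot hν.bot] with p hp using box_ne_bot hp.1 hp.2
  · intro k
    rw [moment_check, moment_check, hμ.odd, hν.odd]

lemma Mo_check (μ ν : Measure EReal) [IsFiniteMeasure μ] [IsFiniteMeasure ν] (k : ℕ) :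
    Mo (mCheck μ ν) k = Mo μ k * Mo ν k := moment_check μ ν _

instance (μ ν : Measure EReal) [IsProbabilityMeasure μ] [IsProbabilityMeasure ν] :
    IsProbabilityMeasure (mCheck μ ν) := by
  rw [mCheck_eq]; exact Measure.isProbabilityMeasure_map measurable_box.aemeasurable

instance (μ ν : Measure EReal) [IsProbabilityMeasure μ] [IsProbabilityMeasure ν] :
    IsProbabilityMeasure (mConv μ ν) :=
  Measure.isProbabilityMeasure_map measurable_add.aemeasurable

lemma ent_conv {μ ν : Measure EReal} [IsProbabilityMeasure μ] [IsProbabilityMeasure ν]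
    (hμ : Good μ) (hν : Good ν) :
    Integrable entFn (mConv μ ν) ∧ E (mConv μ ν) = E μ + E ν - E (mCheck μ ν) := by
  have hm : Measurable fun p : EReal × EReal => p.1 + p.2 := measurable_add
  have hae : (fun p : EReal × EReal => entFn (p.1 + p.2)) =ᵐ[μ.prod ν]
      fun p => entFn p.1 + entFn p.2 - entFn (box p.1 p.2) := by
    filter_upwards [ae_prod_ne_bot hμ.bot hν.bot] with p hp using entFn_dual hp.1 hp.2
  have i1 : Integrable (fun p : EReal × EReal => entFn p.1) (μ.prod ν) := (integrable_ent hμ).comp_fst ν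
  have i2 : Integrable (fun p : EReal × EReal => entFn p.2) (μ.prod ν) := (integrable_ent hν).comp_snd μ
  have i3 : Integrable (fun p : EReal × EReal => entFn (box p.1 p.2)) (μ.prod ν) :=
    (integrable_map_measure measurable_entFn.aestronglyMeasurable measurable_box.aemeasurable).1
      (integrable_ent (hμ.check hν))
  constructor
  · exact (integrable_map_measure measurable_entFn.aestronglyMeasurable hm.aemeasurable).2
      (((i1.add i2).sub i3).congr hae.symm)
  · unfold E
    rw [mConv, integral_map hm.aemeasurable measurable_entFn.aestronglyMeasurable,
      mCheck_eq, integral_map measurable_box.aemeasurable measurable_entFn.aestronglyMeasurable,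
      integral_congr_ae hae, integral_sub (f := fun p => entFn p.1 + entFn p.2) (i1.add i2) i3,
      integral_add i1 i2,
      integral_fun_fst, integral_fun_snd]
    simp

lemma measurable_wt : Measurable wt := by
  unfold wt
  refine Measurable.ite (measurableSet_singleton _) measurable_const
    (Measurable.ite (measurableSet_singleton _) measurable_const ?_)
  have := measurable_ereal_toReal
  fun_prop

lemma IsSymmMeasure.bot {μ : Measure EReal} (h : IsSymmMeasure μ) : ∀ᵐ α ∂μ, α ≠ ⊥ := by
  have h1 := h {⊥} (measurableSet_singleton _)
  have e : (fun a : EReal => -a) ⁻¹' {⊥} = {⊤} := by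
    ext a; simp
  rw [e, lintegral_singleton, lintegral_singleton] at h1
  simp only [wt, if_true, top_ne_bot, if_false, zero_mul] at h1
  have h2 : μ {⊥} = 0 := by
    have := mul_eq_zero.1 h1.symm
    simpa using this
  rw [ae_iff]
  simpa using h2

lemma IsSymmMeasure.map_wt {μ : Measure EReal} (h : IsSymmMeasure μ) :
    (μ.withDensity wt).map (fun a => -a) = μ.withDensity wt := by
  ext A hA
  rw [Measure.map_apply measurable_neg hA, withDensity_apply _ hA,
    withDensity_apply _ (measurable_neg hA)]
  exact h A hA

/-- The even weight `1 / cosh (α / 2)`. -/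
def kap (α : EReal) : ENNReal := ENNReal.ofReal (1 / Real.cosh (α.toReal / 2))

/-- The density `1 - tanh (α / 2)`. -/
def dn (α : EReal) : ENNReal := ENNReal.ofReal (1 - tanhHalf α)

lemma measurable_kap : Measurable kap := by
  unfold kap
  have := measurable_ereal_toReal
  have := Real.measurable_cosh
  fun_prop

lemma measurable_dn : Measurable dn := by
  unfold dn
  have := measurable_th
  fun_prop

lemma kap_neg (α : EReal) : kap (-α) = kap α := by
  unfold kap
  rw [EReal.toReal_neg_eq, neg_div, Real.cosh_neg]

lemma dn_eq {α : EReal} (h : α ≠ ⊥) : dn α = wt α * kap α := by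
  induction α with
  | bot => simp at h
  | top => simp [dn, wt]
  | coe a =>
    simp only [dn, wt, kap, EReal.coe_ne_top, EReal.coe_ne_bot, if_false, EReal.toReal_coe]
    rw [← ENNReal.ofReal_mul (Real.exp_pos _).le, th_coe, Real.cosh_eq]
    congr 1
    have e : Real.exp a = Real.exp (a / 2) * Real.exp (a / 2) := by rw [← Real.exp_add]; ring_nf
    rw [e, neg_div, Real.exp_neg]
    have := Real.exp_pos (a / 2)
    field_simp
    ring

lemma IsSymmMeasure.map_dn {μ : Measure EReal} (h : IsSymmMeasure μ) :
    (μ.withDensity dn).map (fun a => -a) = μ.withDensity dn := by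
  have e : μ.withDensity dn = (μ.withDensity wt).withDensity kap := by
    rw [← withDensity_mul _ measurable_wt measurable_kap]
    apply withDensity_congr_ae
    filter_upwards [h.bot] with α hα using dn_eq hα
  rw [e]
  ext A hA
  rw [Measure.map_apply measurable_neg hA, withDensity_apply _ hA,
    withDensity_apply _ (measurable_neg hA)]
  conv_rhs => rw [← h.map_wt, setLIntegral_map hA measurable_kap measurable_neg]
  simp_rw [kap_neg]

lemma integral_odd_zero {X : Type*} [MeasurableSpace X] {ω : Measure X} {g : X → X}
    (hg : Measurable g) (hω : ω.map g = ω) {F : X → ℝ} (hF : Measurable F)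
    (ho : ∀ x, F (g x) = - F x) : ∫ x, F x ∂ω = 0 := by
  have h : ∫ x, F x ∂ω = ∫ x, F (g x) ∂ω := by
    conv_lhs => rw [← hω]
    exact integral_map hg.aemeasurable hF.aestronglyMeasurable
  simp_rw [ho, integral_neg] at h
  linarith

lemma dn_toReal (α : EReal) : (dn α).toReal = 1 - tanhHalf α :=
  ENNReal.toReal_ofReal (by linarith [th_le α])

lemma good_of_zero {μ : Measure EReal} [IsFiniteMeasure μ] (hb : ∀ᵐ α ∂μ, α ≠ ⊥)
    (h : ∀ k : ℕ, ∫ α, (1 - tanhHalf α) * tanhHalf α ^ (2 * k + 1) ∂μ = 0) : Good μ := by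
  refine ⟨hb, fun k => ?_⟩
  have := h k
  have e : ∀ α, (1 - tanhHalf α) * tanhHalf α ^ (2 * k + 1) =
      tanhHalf α ^ (2 * k + 1) - tanhHalf α ^ (2 * k + 2) := fun α => by ring
  simp_rw [e] at this
  rw [integral_sub (integrable_th_pow μ _) (integrable_th_pow μ _)] at this
  linarith

lemma IsSymmMeasure.good {μ : Measure EReal} [IsFiniteMeasure μ] (h : IsSymmMeasure μ) :
    Good μ := by
  refine good_of_zero h.bot fun k => ?_
  have := integral_odd_zero measurable_neg h.map_dn (measurable_th.pow_const (2 * k + 1))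
    (fun α => by rw [th_neg]; exact Odd.neg_pow ⟨k, rfl⟩ _)
  rw [integral_withDensity_eq_integral_toReal_smul measurable_dn
    (Eventually.of_forall fun α => ENNReal.ofReal_lt_top)] at this
  simpa only [dn_toReal, smul_eq_mul] using this

lemma good_conv {μ ν : Measure EReal} [IsFiniteMeasure μ] [IsFiniteMeasure ν]
    (hμ : IsSymmMeasure μ) (hν : IsSymmMeasure ν) : Good (mConv μ ν) := by
  have hm : Measurable fun p : EReal × EReal => p.1 + p.2 := measurable_add
  have hbb := ae_prod_ne_bot hμ.bot hν.bot
  apply good_of_zero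
  · rw [mConv, ae_map_iff hm.aemeasurable
      (p := fun α : EReal => α ≠ ⊥) (measurableSet_singleton _).compl]
    filter_upwards [hbb] with p hp
    simp [EReal.add_eq_bot_iff, hp.1, hp.2]
  · intro k
    have mt := measurable_th
    rw [mConv, integral_map hm.aemeasurable (Measurable.aestronglyMeasurable (by fun_prop))]
    have hab : ∀ a, |1 - tanhHalf a| ≤ 2 := fun a =>
      abs_le.2 ⟨by linarith [th_le a], by linarith [neg_one_le_th a]⟩
    have fin1 : IsFiniteMeasure (μ.withDensity dn) :=
      isFiniteMeasure_withDensity_ofReal (integrable_bdd μ (f := fun a => 1 - tanhHalf a)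
        (measurable_const.sub mt) 2 hab).2
    have fin2 : IsFiniteMeasure (ν.withDensity dn) :=
      isFiniteMeasure_withDensity_ofReal (integrable_bdd ν (f := fun a => 1 - tanhHalf a)
        (measurable_const.sub mt) 2 hab).2
    have hmap : ((μ.withDensity dn).prod (ν.withDensity dn)).map (Prod.map (fun a => -a) (fun a => -a))
        = (μ.withDensity dn).prod (ν.withDensity dn) := by
      rw [← Measure.map_prod_map _ _ measurable_neg measurable_neg, hμ.map_dn, hν.map_dn]
    have hF : Measurable fun p : EReal × EReal =>
        ((tanhHalf p.1 + tanhHalf p.2) / (1 + tanhHalf p.1 * tanhHalf p.2)) ^ (2 * k + 1)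
          / (1 + tanhHalf p.1 * tanhHalf p.2) := by fun_prop
    have h0 := integral_odd_zero (measurable_neg.prodMap measurable_neg) hmap hF (fun p => by
      simp only [Prod.map_fst, Prod.map_snd, th_neg, neg_mul_neg]
      rw [← neg_add, neg_div, Odd.neg_pow ⟨k, rfl⟩, neg_div])
    rw [prod_withDensity measurable_dn measurable_dn,
      integral_withDensity_eq_integral_toReal_smul
        (f := fun z : EReal × EReal => dn z.1 * dn z.2)
        ((measurable_dn.comp measurable_fst).mul (measurable_dn.comp measurable_snd))
        (Eventually.of_forall fun α => ENNReal.mul_lt_top ENNReal.ofReal_lt_top ENNReal.ofReal_lt_top)]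
      at h0
    simp only [ENNReal.toReal_mul, dn_toReal, smul_eq_mul] at h0
    rw [← h0]
    apply integral_congr_ae
    filter_upwards [hbb] with p hp
    have hpos := one_add_th_pos hp.1 hp.2
    rw [th_add hp.1 hp.2]
    have e : 1 - (tanhHalf p.1 + tanhHalf p.2) / (1 + tanhHalf p.1 * tanhHalf p.2) =
        (1 - tanhHalf p.1) * (1 - tanhHalf p.2) / (1 + tanhHalf p.1 * tanhHalf p.2) := by
      field_simp; ring
    rw [e]
    ring

/- Signed measures. -/

lemma jp_sub (μ ν : Measure EReal) [IsFiniteMeasure μ] [IsFiniteMeasure ν] :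
    jp (μ.toSignedMeasure - ν.toSignedMeasure) = μ - ν := by
  unfold jp
  rw [Measure.toJordanDecomposition_toSignedMeasure_sub]; rfl

lemma jn_sub (μ ν : Measure EReal) [IsFiniteMeasure μ] [IsFiniteMeasure ν] :
    jn (μ.toSignedMeasure - ν.toSignedMeasure) = ν - μ := by
  unfold jn
  rw [Measure.toJordanDecomposition_toSignedMeasure_sub]; rfl

lemma jp_add (μ ν : Measure EReal) [IsFiniteMeasure μ] [IsFiniteMeasure ν] :
    jp (μ.toSignedMeasure - ν.toSignedMeasure) + ν
      = jn (μ.toSignedMeasure - ν.toSignedMeasure) + μ := by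
  rw [← Measure.toSignedMeasure_eq_toSignedMeasure_iff, Measure.toSignedMeasure_add,
    Measure.toSignedMeasure_add]
  have h := SignedMeasure.toSignedMeasure_toJordanDecomposition
    (μ.toSignedMeasure - ν.toSignedMeasure)
  have h' : (jp (μ.toSignedMeasure - ν.toSignedMeasure)).toSignedMeasure -
     (jn (μ.toSignedMeasure - ν.toSignedMeasure)).toSignedMeasure
     = μ.toSignedMeasure - ν.toSignedMeasure := h
  rw [sub_eq_sub_iff_add_eq_add] at h'
  rw [h', add_comm]

lemma sInt_sub (μ ν : Measure EReal) [IsFiniteMeasure μ] [IsFiniteMeasure ν] {f : EReal → ℝ}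
    (hμ : Integrable f μ) (hν : Integrable f ν) :
    sInt f (μ.toSignedMeasure - ν.toSignedMeasure) = ∫ α, f α ∂μ - ∫ α, f α ∂ν := by
  have i1 : Integrable f (jp (μ.toSignedMeasure - ν.toSignedMeasure)) := by
    rw [jp_sub]; exact hμ.mono_measure Measure.sub_le
  have i2 : Integrable f (jn (μ.toSignedMeasure - ν.toSignedMeasure)) := by
    rw [jn_sub]; exact hν.mono_measure Measure.sub_le
  have h := congrArg (fun m => ∫ α, f α ∂m) (jp_add μ ν)
  rw [integral_add_measure i1 hν, integral_add_measure i2 hμ] at h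
  unfold sInt
  linarith

lemma sub_zero_sm (μ : Measure EReal) [IsFiniteMeasure μ] :
    μ.toSignedMeasure = μ.toSignedMeasure - (0 : Measure EReal).toSignedMeasure := by
  rw [Measure.toSignedMeasure_zero, sub_zero]

lemma sInt_one (μ : Measure EReal) [IsFiniteMeasure μ] {f : EReal → ℝ}
    (hμ : Integrable f μ) :
    sInt f μ.toSignedMeasure = ∫ α, f α ∂μ := by
  rw [sub_zero_sm, sInt_sub _ _ hμ (integrable_zero_measure)]
  simp

lemma MemX.exists {x : SM} (h : MemX x) : ∃ (μ : Measure EReal) (_ : IsProbabilityMeasure μ),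
    x = μ.toSignedMeasure ∧ IsSymmMeasure μ := by
  obtain ⟨⟨μ, hμ, rfl⟩, hs, -⟩ := h
  refine ⟨μ, hμ, rfl, ?_⟩
  have : jp μ.toSignedMeasure = μ := by
    rw [sub_zero_sm, jp_sub]
    simp
  simpa only [this] using hs

lemma bil (B : Measure EReal → Measure EReal → Measure EReal)
    [hB : ∀ μ ν, [IsFiniteMeasure μ] → [IsFiniteMeasure ν] → IsFiniteMeasure (B μ ν)]
    (hl : ∀ μ μ' ν, [IsFiniteMeasure μ] → [IsFiniteMeasure μ'] → [IsFiniteMeasure ν] →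
      B (μ + μ') ν = B μ ν + B μ' ν)
    (hr : ∀ ν μ μ', [IsFiniteMeasure μ] → [IsFiniteMeasure μ'] → [IsFiniteMeasure ν] →
      B ν (μ + μ') = B ν μ + B ν μ')
    (μ ν μ' ν' : Measure EReal) [IsFiniteMeasure μ] [IsFiniteMeasure ν] [IsFiniteMeasure μ']
    [IsFiniteMeasure ν'] (x y : SM) (hx : x = μ.toSignedMeasure - ν.toSignedMeasure)
    (hy : y = μ'.toSignedMeasure - ν'.toSignedMeasure) :
    (B (jp x) (jp y)).toSignedMeasure - (B (jp x) (jn y)).toSignedMeasure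
      - (B (jn x) (jp y)).toSignedMeasure + (B (jn x) (jn y)).toSignedMeasure
    = (B μ μ' + B ν ν').toSignedMeasure - (B μ ν' + B ν μ').toSignedMeasure := by
  have h1 : ∀ (q : Measure EReal) [IsFiniteMeasure q],
      (B (jp x) q).toSignedMeasure - (B (jn x) q).toSignedMeasure
        = (B μ q).toSignedMeasure - (B ν q).toSignedMeasure := by
    intro q _
    have e : B (jp x) q + B ν q = B (jn x) q + B μ q := by
      rw [← hl, ← hl, hx, jp_add]
    have := Measure.toSignedMeasure_congr e
    rw [Measure.toSignedMeasure_add, Measure.toSignedMeasure_add] at this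
    rw [sub_eq_sub_iff_add_eq_add, this, add_comm]
  have h2 : ∀ (q : Measure EReal) [IsFiniteMeasure q],
      (B q (jp y)).toSignedMeasure - (B q (jn y)).toSignedMeasure
        = (B q μ').toSignedMeasure - (B q ν').toSignedMeasure := by
    intro q _
    have e : B q (jp y) + B q ν' = B q (jn y) + B q μ' := by
      rw [← hr, ← hr, hy, jp_add]
    have := Measure.toSignedMeasure_congr e
    rw [Measure.toSignedMeasure_add, Measure.toSignedMeasure_add] at this
    rw [sub_eq_sub_iff_add_eq_add, this, add_comm]
  rw [Measure.toSignedMeasure_add, Measure.toSignedMeasure_add]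
  have a1 := h1 (jp y)
  have a2 := h1 (jn y)
  have a3 := h2 μ
  have a4 := h2 ν
  rw [sub_eq_iff_eq_add] at a1 a2 a3 a4
  rw [a1, a2, a3, a4]
  abel

lemma mConv_eq (μ ν : Measure EReal) : mConv μ ν = Measure.conv μ ν := rfl

lemma mCheck_add_left (μ μ' ν : Measure EReal) [IsFiniteMeasure μ] [IsFiniteMeasure μ']
    [IsFiniteMeasure ν] : mCheck (μ + μ') ν = mCheck μ ν + mCheck μ' ν := by
  simp only [mCheck_eq]
  rw [Measure.add_prod, Measure.map_add _ _ measurable_box]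

lemma mCheck_add_right (ν μ μ' : Measure EReal) [IsFiniteMeasure μ] [IsFiniteMeasure μ']
    [IsFiniteMeasure ν] : mCheck ν (μ + μ') = mCheck ν μ + mCheck ν μ' := by
  simp only [mCheck_eq]
  rw [Measure.prod_add, Measure.map_add _ _ measurable_box]

lemma mConv_add_left (μ μ' ν : Measure EReal) [IsFiniteMeasure μ] [IsFiniteMeasure μ']
    [IsFiniteMeasure ν] : mConv (μ + μ') ν = mConv μ ν + mConv μ' ν := by
  simp only [mConv_eq, Measure.add_conv]

lemma mConv_add_right (ν μ μ' : Measure EReal) [IsFiniteMeasure μ] [IsFiniteMeasure μ']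
    [IsFiniteMeasure ν] : mConv ν (μ + μ') = mConv ν μ + mConv ν μ' := by
  simp only [mConv_eq, Measure.conv_add]

/-- Entropy of a threefold signed product, for a generic bilinear operation. -/
lemma triple (B : Measure EReal → Measure EReal → Measure EReal)
    [hB : ∀ μ ν, [IsFiniteMeasure μ] → [IsFiniteMeasure ν] → IsFiniteMeasure (B μ ν)]
    (hl : ∀ μ μ' ν, [IsFiniteMeasure μ] → [IsFiniteMeasure μ'] → [IsFiniteMeasure ν] →
      B (μ + μ') ν = B μ ν + B μ' ν)
    (hr : ∀ ν μ μ', [IsFiniteMeasure μ] → [IsFiniteMeasure μ'] → [IsFiniteMeasure ν] →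
      B ν (μ + μ') = B ν μ + B ν μ') (hz : ∀ μ, B μ 0 = 0)
    (S : SM → SM → SM)
    (hS : ∀ x y, S x y = (B (jp x) (jp y)).toSignedMeasure - (B (jp x) (jn y)).toSignedMeasure
      - (B (jn x) (jp y)).toSignedMeasure + (B (jn x) (jn y)).toSignedMeasure)
    (m1 m1' m2 m3 m4 : Measure EReal) [IsFiniteMeasure m1] [IsFiniteMeasure m1']
    [IsFiniteMeasure m2] [IsFiniteMeasure m3] [IsFiniteMeasure m4]
    (i1 : Integrable entFn (B (B m1' m2) m4)) (i2 : Integrable entFn (B (B m1 m3) m4))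
    (i3 : Integrable entFn (B (B m1' m3) m4)) (i4 : Integrable entFn (B (B m1 m2) m4)) :
    H (S (S (m1'.toSignedMeasure - m1.toSignedMeasure) (m2.toSignedMeasure - m3.toSignedMeasure))
      m4.toSignedMeasure) = E (B (B m1' m2) m4) + E (B (B m1 m3) m4)
        - (E (B (B m1' m3) m4) + E (B (B m1 m2) m4)) := by
  rw [hS (S _ _), bil B (hB := hB) hl hr _ _ m4 0 _ _
    ((hS _ _).trans (bil B (hB := hB) hl hr m1' m1 m2 m3 _ _ rfl rfl)) (sub_zero_sm m4)]
  unfold H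
  have e1 : B (B m1' m2 + B m1 m3) m4 + B (B m1' m3 + B m1 m2) 0
      = B (B m1' m2) m4 + B (B m1 m3) m4 := by rw [hz, add_zero, hl]
  have e2 : B (B m1' m2 + B m1 m3) 0 + B (B m1' m3 + B m1 m2) m4
      = B (B m1' m3) m4 + B (B m1 m2) m4 := by rw [hz, zero_add, hl]
  rw [sInt_sub]
  · rw [e1, e2, integral_add_measure i1 i2, integral_add_measure i3 i4]; rfl
  · rw [e1]; exact i1.add_measure i2
  · rw [e2]; exact i3.add_measure i4

lemma Mo_deg {m1 m1' : Measure EReal} [IsFiniteMeasure m1] [IsFiniteMeasure m1']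
    (h : Degraded m1'.toSignedMeasure m1.toSignedMeasure) (k : ℕ) : Mo m1' k ≤ Mo m1 k := by
  have h1 := h (fun u => - u ^ (2 * k + 2))
    ((Even.convexOn_pow (n := 2 * k + 2) ⟨k + 1, by ring⟩).subset (Set.subset_univ _)
      (convex_Icc 0 1)).neg
    (fun a ha b _ hab => neg_le_neg (pow_le_pow_left₀ ha.1 hab _))
  have e : ∀ α, |tanhHalf α| ^ (2 * k + 2) = tanhHalf α ^ (2 * k + 2) := fun α =>
    Even.pow_abs ⟨k + 1, by ring⟩ _
  unfold If at h1
  simp only [e] at h1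
  rw [sInt_one (f := fun α => - tanhHalf α ^ (2 * k + 2)) _ (integrable_th_pow m1 _).neg,
    sInt_one (f := fun α => - tanhHalf α ^ (2 * k + 2)) _ (integrable_th_pow m1' _).neg,
    integral_neg, integral_neg] at h1
  exact neg_le_neg_iff.1 h1

lemma final_bound {m1 m1' : Measure EReal} [IsProbabilityMeasure m1] [IsProbabilityMeasure m1']
    (g1 : Good m1) (g1' : Good m1') (hd : ∀ k, Mo m1' k ≤ Mo m1 k) (w : ℕ → ℝ)
    (hw : ∀ k, |w k| ≤ 1) (A : ℝ)
    (hA : HasSum (fun k => cc k * ((Mo m1 k - Mo m1' k) * w k) / Real.log 2) A) :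
    |A| ≤ E m1' - E m1 := by
  have h := (hasSum_E g1).sub (hasSum_E g1')
  have hp : ∀ k, 0 ≤ cc k * (Mo m1 k - Mo m1' k) / Real.log 2 := fun k =>
    div_nonneg (mul_nonneg (cc_nonneg k) (sub_nonneg.2 (hd k))) (by positivity)
  have hle : ∀ k, |cc k * ((Mo m1 k - Mo m1' k) * w k) / Real.log 2| ≤
      cc k * Mo m1 k / Real.log 2 - cc k * Mo m1' k / Real.log 2 := fun k => by
    have e : cc k * ((Mo m1 k - Mo m1' k) * w k) / Real.log 2
      = (cc k * (Mo m1 k - Mo m1' k) / Real.log 2) * w k := by ring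
    rw [e, abs_mul, abs_of_nonneg (hp k)]
    have := mul_le_mul_of_nonneg_left (hw k) (hp k)
    calc _ ≤ _ := this
      _ = _ := by ring
  have e : (1 - E m1) - (1 - E m1') = E m1' - E m1 := by ring
  rw [e] at h
  rw [abs_le]
  constructor
  · exact hasSum_le (fun k => (abs_le.1 (hle k)).1) h.neg hA
  · exact hasSum_le (fun k => (abs_le.1 (hle k)).2) hA h

/-- If `x1, x1', x2, x3, x4 ∈ X` with `x1' ⪰ x1`, then
`|H((x1' - x1) ∗ (x2 - x3) ∗ x4)| ≤ H(x1' - x1)` for `∗` either `⊛` or `⊠`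
(the same operation in both places). -/
theorem entropy_bound_three_variables
    (x1 x1' x2 x3 x4 : SM)
    (h1 : MemX x1) (h1' : MemX x1') (h2 : MemX x2) (h3 : MemX x3) (h4 : MemX x4)
    (hdeg : Degraded x1' x1) :
    |H (sConv (sConv (x1' - x1) (x2 - x3)) x4)| ≤ H (x1' - x1) ∧
    |H (sCheck (sCheck (x1' - x1) (x2 - x3)) x4)| ≤ H (x1' - x1) := by
  obtain ⟨m1, _, rfl, s1⟩ := h1.exists
  obtain ⟨m1', _, rfl, s1'⟩ := h1'.exists
  obtain ⟨m2, _, rfl, s2⟩ := h2.exists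
  obtain ⟨m3, _, rfl, s3⟩ := h3.exists
  obtain ⟨m4, _, rfl, s4⟩ := h4.exists
  have g1 := s1.good
  have g1' := s1'.good
  have g2 := s2.good
  have g3 := s3.good
  have g4 := s4.good
  have hd := Mo_deg hdeg
  have hrhs : H (m1'.toSignedMeasure - m1.toSignedMeasure) = E m1' - E m1 :=
    sInt_sub _ _ (integrable_ent g1') (integrable_ent g1)
  rw [hrhs]
  constructor
  · have g24 := good_conv s2 s4
    have g34 := good_conv s3 s4
    have as : ∀ a b c : Measure EReal, [IsFiniteMeasure a] → [IsFiniteMeasure b] →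
        [IsFiniteMeasure c] → mConv (mConv a b) c = mConv a (mConv b c) := fun a b c _ _ _ => by
      simp only [mConv_eq, Measure.conv_assoc]
    have c1 := ent_conv g1' g24
    have c2 := ent_conv g1 g34
    have c3 := ent_conv g1' g34
    have c4 := ent_conv g1 g24
    rw [triple mConv (hB := fun _ _ _ _ => inferInstance) mConv_add_left mConv_add_right (fun μ => by simp [mConv]) sConv
      (fun _ _ => rfl)]
    · simp only [as]
      rw [c1.2, c2.2, c3.2, c4.2]
      refine final_bound g1 g1' hd (fun k => - (Mo (mConv m2 m4) k - Mo (mConv m3 m4) k))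
        (fun k => ?_) _ ?_
      · have := Mo_nonneg (mConv m2 m4) k
        have := Mo_nonneg (mConv m3 m4) k
        have := Mo_le_one (mConv m2 m4) k
        have := Mo_le_one (mConv m3 m4) k
        rw [abs_le]; constructor <;> linarith
      · have hs := ((hasSum_E (g1'.check g24)).add (hasSum_E (g1.check g34))).sub
          ((hasSum_E (g1'.check g34)).add (hasSum_E (g1.check g24)))
        simp only [Mo_check] at hs
        convert hs using 1
        · rfl
        · funext k; ring
        · ring
    · rw [as]; exact c1.1
    · rw [as]; exact c2.1
    · rw [as]; exact c3.1
    · rw [as]; exact c4.1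
  · have c1 := (g1'.check g2).check g4
    have c2 := (g1.check g3).check g4
    have c3 := (g1'.check g3).check g4
    have c4 := (g1.check g2).check g4
    rw [triple mCheck (hB := fun _ _ _ _ => inferInstance) mCheck_add_left mCheck_add_right (fun μ => by simp [mCheck]) sCheck
      (fun _ _ => rfl) _ _ _ _ _ (integrable_ent c1) (integrable_ent c2) (integrable_ent c3)
      (integrable_ent c4)]
    refine final_bound g1 g1' hd (fun k => (Mo m2 k - Mo m3 k) * Mo m4 k)
        (fun k => ?_) _ ?_
    · have := Mo_nonneg m2 k
      have := Mo_nonneg m3 k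
      have := Mo_le_one m2 k
      have := Mo_le_one m3 k
      rw [abs_mul]
      refine mul_le_one₀ ?_ (abs_nonneg _) ?_
      · rw [abs_le]; constructor <;> linarith
      · rw [abs_of_nonneg (Mo_nonneg m4 k)]; exact Mo_le_one m4 k
    · have hs := ((hasSum_E c3).add (hasSum_E c4)).sub ((hasSum_E c1).add (hasSum_E c2))
      simp only [Mo_check] at hs
      convert hs using 1
      · rfl
      · funext k; ring
      · ring

end SCLDPC
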